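/- Let d be a positive integer and s ∈ (0,1) with d + 2s ≥ 4, set m := (d−2s)/2, and let x₁, x₂, x₃ ∈ ℝ^d be pairwise distinct. Then the integral ∫_{ℝ^d} (1 − |x₁−x₂|^m/|y−x₂|^m)·(1 − |x₁−x₃|^m/|y−x₃|^m)·|x₁−y|^{−(d+2s)} dy converges absolutely, and 2·a_{s,d} times this integral equals C_{fH}(d,s) · [ 1/|x₁−x₂|^{2s} + 1/|x₁−x₃|^{2s} + 2·((x₃−x₁)·(x₂−x₁)) / (|x₃−x₁|^{2s}·|x₂−x₁|^{2s}·|x₂−x₃|^{2−2s}) − |x₁−x₃|^{2−2s}/(|x₁−x₂|^{2s}·|x₂−x₃|^{2−2s}) − |x₁−x₂|^{2−2s}/(|x₁−x₃|^{2s}·|x₂−x₃|^{2−2s}) ]. -/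

import Mathlib

open MeasureTheory Real
open scoped RealInnerProductSpace

noncomputable section

/-- `ℝ^d` as a Euclidean space. -/
abbrev Euc (d : ℕ) := EuclideanSpace ℝ (Fin d)

/-- The normalisation constant `a_{s,d}` of the fractional Laplacian. -/
def a_sd (d : ℕ) (s : ℝ) : ℝ :=
  s * (2:ℝ) ^ (2*s - 1) * Real.pi ^ (-(d:ℝ)/2) * Real.Gamma (((d:ℝ) + 2*s)/2) /
    Real.Gamma (1 - s)

/-- The sharp fractional Hardy constant `C_{fH}(d,s)`. -/
def C_fH (d : ℕ) (s : ℝ) : ℝ :=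
  (2:ℝ) ^ (2*s) * (Real.Gamma (((d:ℝ) + 2*s)/4))^2 / (Real.Gamma (((d:ℝ) - 2*s)/4))^2

theorem integrableOn_rpow_mul_exp_neg_mul {a c : ℝ} (ha : 0 < a) (hc : 0 < c) :
    IntegrableOn (fun t : ℝ => t ^ (a - 1) * exp (-(c * t))) (Set.Ioi 0) := by
  simpa using integrableOn_rpow_mul_exp_neg_mul_rpow (s := a - 1) (p := 1) (by linarith) one_pos hc

theorem lintegral_rpow_mul_exp_neg_mul {a c : ℝ} (ha : 0 < a) (hc : 0 < c) :
    ∫⁻ t in Set.Ioi (0:ℝ), ENNReal.ofReal (t ^ (a - 1) * exp (-(c * t))) =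
      ENNReal.ofReal (Gamma a * c ^ (-a)) := by
  rw [← ofReal_integral_eq_lintegral_ofReal (integrableOn_rpow_mul_exp_neg_mul ha hc),
    integral_rpow_mul_exp_neg_mul_Ioi ha hc, one_div, inv_rpow hc.le, rpow_neg hc.le, mul_comm]
  filter_upwards [ae_restrict_mem measurableSet_Ioi] with t ht
  have : (0:ℝ) < t := ht
  simp only [Pi.zero_apply]
  positivity

theorem lintegral_rpow_mul_abs_exp_sub {a A B : ℝ} (ha : 0 < a) (hA : 0 < A) (hB : 0 < B) :
    ∫⁻ t in Set.Ioi (0:ℝ), ENNReal.ofReal (t ^ (a - 1) * |exp (-(A * t)) - exp (-(B * t))|) =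
      ENNReal.ofReal (Gamma a * |A ^ (-a) - B ^ (-a)|) := by
  wlog hAB : A ≤ B generalizing A B
  · simpa only [abs_sub_comm] using this hB hA (le_of_not_ge hAB)
  have h1 := integrableOn_rpow_mul_exp_neg_mul ha hA
  have h2 := integrableOn_rpow_mul_exp_neg_mul ha hB
  have hle : B ^ (-a) ≤ A ^ (-a) := rpow_le_rpow_of_nonpos hA hAB (by linarith)
  have key : ∀ t ∈ Set.Ioi (0:ℝ), t ^ (a - 1) * |exp (-(A * t)) - exp (-(B * t))| =
      t ^ (a - 1) * exp (-(A * t)) - t ^ (a - 1) * exp (-(B * t)) := by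
    intro t (ht : 0 < t)
    rw [abs_of_nonneg, mul_sub]
    rw [sub_nonneg, exp_le_exp]
    nlinarith
  rw [← ofReal_integral_eq_lintegral_ofReal, setIntegral_congr_fun measurableSet_Ioi key,
    integral_sub h1 h2, integral_rpow_mul_exp_neg_mul_Ioi ha hA,
    integral_rpow_mul_exp_neg_mul_Ioi ha hB, abs_of_nonneg (sub_nonneg.2 hle),
    one_div, one_div, inv_rpow hA.le, inv_rpow hB.le, rpow_neg hA.le, rpow_neg hB.le]
  · ring_nf
  · exact (h1.sub h2).congr_fun (fun t ht => (key t ht).symm) measurableSet_Ioi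
  · filter_upwards [ae_restrict_mem measurableSet_Ioi] with t ht
    have : (0:ℝ) < t := ht
    simp only [Pi.zero_apply]
    positivity

theorem lintegral_rpow_mul_one_add_rpow {a b : ℝ} (ha : 0 < a) (hb : 0 < b) :
    ∫⁻ v in Set.Ioi (0:ℝ), ENNReal.ofReal (v ^ (a - 1) * (1 + v) ^ (-(a + b))) =
      ENNReal.ofReal (Gamma a * Gamma b / Gamma (a + b)) := by
  have hG : 0 < Gamma (a + b) := Gamma_pos_of_pos (by linarith)
  have h1 : ∀ v ∈ Set.Ioi (0:ℝ), ENNReal.ofReal (v ^ (a - 1) * (1 + v) ^ (-(a + b))) =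
      ∫⁻ t in Set.Ioi (0:ℝ), ENNReal.ofReal (v ^ (a - 1) / Gamma (a + b)) *
        ENNReal.ofReal (t ^ (a + b - 1) * exp (-((1 + v) * t))) := by
    intro v (hv : 0 < v)
    rw [lintegral_const_mul _ (by fun_prop),
      lintegral_rpow_mul_exp_neg_mul (by linarith) (by linarith), ← ENNReal.ofReal_mul (by positivity)]
    congr 1
    field_simp
  have h2 : ∀ t ∈ Set.Ioi (0:ℝ), ∫⁻ v in Set.Ioi (0:ℝ), ENNReal.ofReal (v ^ (a - 1) / Gamma (a + b)) *
        ENNReal.ofReal (t ^ (a + b - 1) * exp (-((1 + v) * t))) =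
      ENNReal.ofReal (Gamma a / Gamma (a + b)) * ENNReal.ofReal (t ^ (b - 1) * exp (-(1 * t))) := by
    intro t (ht : 0 < t)
    have : ∀ v ∈ Set.Ioi (0:ℝ), ENNReal.ofReal (v ^ (a - 1) / Gamma (a + b)) *
        ENNReal.ofReal (t ^ (a + b - 1) * exp (-((1 + v) * t))) =
        ENNReal.ofReal (t ^ (a + b - 1) * exp (-t) / Gamma (a + b)) *
          ENNReal.ofReal (v ^ (a - 1) * exp (-(t * v))) := by
      intro v (hv : 0 < v)
      rw [← ENNReal.ofReal_mul (by positivity), ← ENNReal.ofReal_mul (by positivity),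
        show -((1 + v) * t) = -t + -(t * v) by ring, exp_add]
      ring_nf
    rw [setLIntegral_congr_fun measurableSet_Ioi this, lintegral_const_mul _ (by fun_prop),
      lintegral_rpow_mul_exp_neg_mul ha ht, ← ENNReal.ofReal_mul (by positivity),
      ← ENNReal.ofReal_mul (by have := Gamma_pos_of_pos ha; positivity),
      show a + b - 1 = (b - 1) + a by ring, rpow_add ht, rpow_neg ht.le]
    congr 1
    field_simp
  rw [setLIntegral_congr_fun measurableSet_Ioi h1, lintegral_lintegral_swap (by fun_prop),
    setLIntegral_congr_fun measurableSet_Ioi h2, lintegral_const_mul _ (by fun_prop),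
    lintegral_rpow_mul_exp_neg_mul hb one_pos,
    ← ENNReal.ofReal_mul (by have := Gamma_pos_of_pos ha; positivity), one_rpow]
  ring_nf

theorem lintegral_rpow_mul_one_sub_exp {s k : ℝ} (hs : s ∈ Set.Ioo (0:ℝ) 1) (hk : 0 ≤ k) :
    ∫⁻ t in Set.Ioi (0:ℝ), ENNReal.ofReal (t ^ (-1 - s) * (1 - exp (-(k * t)))) =
      ENNReal.ofReal (Gamma (1 - s) / s * k ^ s) := by
  obtain ⟨hs0, hs1⟩ := hs
  have h1 : ∀ t ∈ Set.Ioi (0:ℝ), ENNReal.ofReal (t ^ (-1 - s) * (1 - exp (-(k * t)))) =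
      ∫⁻ u in Set.Ioc 0 k, ENNReal.ofReal (t ^ ((1 - s) - 1) * exp (-(u * t))) := by
    intro t (ht : 0 < t)
    rw [← ofReal_integral_eq_lintegral_ofReal, ← intervalIntegral.integral_of_le hk]
    · have hd : ∀ u ∈ Set.uIcc 0 k, HasDerivAt (fun u => -(t ^ (-1 - s) * exp (-(u * t))))
          (t ^ ((1 - s) - 1) * exp (-(u * t))) u := by
        intro u _
        have := ((((hasDerivAt_id u).mul_const t).neg.exp).const_mul (t ^ (-1 - s))).neg
        refine this.congr_deriv ?_
        rw [show 1 - s - 1 = (-1 - s) + 1 by ring, rpow_add_one ht.ne']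
        simp only [id, Pi.neg_apply]
        ring
      rw [intervalIntegral.integral_eq_sub_of_hasDerivAt hd
        (Continuous.intervalIntegrable (by fun_prop) _ _)]
      simp
      ring_nf
    · exact (Continuous.integrableOn_Icc (by fun_prop)).mono_set Set.Ioc_subset_Icc_self
    · exact Filter.Eventually.of_forall fun u => by simp only [Pi.zero_apply]; positivity
  have h2 : ∀ u ∈ Set.Ioc 0 k,
      ∫⁻ t in Set.Ioi (0:ℝ), ENNReal.ofReal (t ^ ((1 - s) - 1) * exp (-(u * t))) =
      ENNReal.ofReal (Gamma (1 - s) * u ^ (s - 1)) := by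
    intro u hu
    rw [lintegral_rpow_mul_exp_neg_mul (by linarith) hu.1, neg_sub]
  have hG := Gamma_pos_of_pos (sub_pos.2 hs1)
  rw [setLIntegral_congr_fun measurableSet_Ioi h1, lintegral_lintegral_swap (by fun_prop),
    setLIntegral_congr_fun measurableSet_Ioc h2, ← ofReal_integral_eq_lintegral_ofReal,
    ← intervalIntegral.integral_of_le hk, intervalIntegral.integral_const_mul,
    integral_rpow (by left; linarith)]
  · simp [zero_rpow hs0.ne']
    ring_nf
  · rw [← IntegrableOn, ← intervalIntegrable_iff_integrableOn_Ioc_of_le hk]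
    exact (intervalIntegral.intervalIntegrable_rpow' (by linarith)).const_mul _
  · filter_upwards [ae_restrict_mem measurableSet_Ioc] with t ht
    have := ht.1
    simp only [Pi.zero_apply]
    positivity

theorem lintegral_Ioi_comp_mul_left {t : ℝ} (ht : 0 < t) (f : ℝ → ENNReal) :
    ∫⁻ x in Set.Ioi (0:ℝ), f x = ∫⁻ v in Set.Ioi (0:ℝ), ENNReal.ofReal t * f (t * v) := by
  have := lintegral_image_eq_lintegral_abs_deriv_mul (s := Set.Ioi (0:ℝ)) (f := fun v => t * v)
    (f' := fun _ => t) measurableSet_Ioi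
    (fun x _ => by simpa using ((hasDerivAt_id x).const_mul t).hasDerivWithinAt)
    (fun x _ y _ h => mul_left_cancel₀ ht.ne' h) f
  rwa [abs_of_pos ht, Set.image_const_mul_Ioi_zero ht] at this

section
variable {V : Type*} [NormedAddCommGroup V] [InnerProductSpace ℝ V] [FiniteDimensional ℝ V]
  [MeasurableSpace V] [BorelSpace V]

open Module (finrank)

theorem mul_norm_sub_sq_add_mul_norm_sub_sq {V : Type*} [NormedAddCommGroup V]
    [InnerProductSpace ℝ V] {t τ : ℝ} (ht : t + τ ≠ 0) (z p q : V) :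
    t * ‖z - p‖ ^ 2 + τ * ‖z - q‖ ^ 2 =
      (t + τ) * ‖z - (t + τ)⁻¹ • (t • p + τ • q)‖ ^ 2 + t * τ / (t + τ) * ‖p - q‖ ^ 2 := by
  simp only [norm_sub_sq_real, norm_add_sq_real, norm_smul, inner_add_right,
    inner_smul_left, inner_smul_right, mul_pow, norm_eq_abs, sq_abs, conj_trivial]
  field_simp
  ring

theorem integrable_exp_neg_mul_norm_sub_sq {b : ℝ} (hb : 0 < b) (p : V) :
    Integrable fun z : V => exp (-(b * ‖z - p‖ ^ 2)) := by
  have : Integrable fun z : V => exp (-b * ‖z‖ ^ 2) := by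
    apply not_imp_comm.1 integral_undef
    rw [GaussianFourier.integral_rexp_neg_mul_sq_norm hb]
    positivity
  simpa using this.comp_sub_right p

theorem integral_exp_neg_mul_norm_sub_sq {b : ℝ} (hb : 0 < b) (p : V) :
    ∫ z : V, exp (-(b * ‖z - p‖ ^ 2)) = (π / b) ^ (finrank ℝ V / 2 : ℝ) := by
  rw [integral_sub_right_eq_self (fun z : V => exp (-(b * ‖z‖ ^ 2))) p,
    ← GaussianFourier.integral_rexp_neg_mul_sq_norm hb]
  simp

theorem integral_exp_mul_exp_neg_norm_sub_sq {t τ : ℝ} (ht : 0 < t) (hτ : 0 < τ) (p q : V) :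
    Integrable (fun z : V => exp (-(t * ‖z - p‖ ^ 2)) * exp (-(τ * ‖z - q‖ ^ 2))) ∧
    ∫ z : V, exp (-(t * ‖z - p‖ ^ 2)) * exp (-(τ * ‖z - q‖ ^ 2)) =
      (π / (t + τ)) ^ (finrank ℝ V / 2 : ℝ) * exp (-(t * τ / (t + τ) * ‖p - q‖ ^ 2)) := by
  have hs : 0 < t + τ := add_pos ht hτ
  have : (fun z : V => exp (-(t * ‖z - p‖ ^ 2)) * exp (-(τ * ‖z - q‖ ^ 2))) = fun z : V =>
      exp (-((t + τ) * ‖z - (t + τ)⁻¹ • (t • p + τ • q)‖ ^ 2)) *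
        exp (-(t * τ / (t + τ) * ‖p - q‖ ^ 2)) := by
    ext z
    rw [← exp_add, ← exp_add, ← neg_add, mul_norm_sub_sq_add_mul_norm_sub_sq hs.ne', neg_add]
  rw [this]
  exact ⟨(integrable_exp_neg_mul_norm_sub_sq hs _).mul_const _, by
    rw [integral_mul_const, integral_exp_neg_mul_norm_sub_sq hs]⟩

theorem abs_exp_sub_mul_abs_exp_sub {t τ A B : ℝ} (ht : 0 < t) (hτ : 0 < τ) :
    |exp (-(A * t)) - exp (-(B * t))| * |exp (-(A * τ)) - exp (-(B * τ))| =
      (exp (-(A * t)) - exp (-(B * t))) * (exp (-(A * τ)) - exp (-(B * τ))) := by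
  rw [← abs_mul, abs_of_nonneg]
  rcases le_total A B with h | h
  · apply mul_nonneg <;> rw [sub_nonneg, exp_le_exp] <;> nlinarith
  · apply mul_nonneg_of_nonpos_of_nonpos <;> rw [sub_nonpos, exp_le_exp] <;> nlinarith

theorem lintegral_abs_exp_sub_mul_abs_exp_sub {t τ : ℝ} (ht : 0 < t) (hτ : 0 < τ) (p q : V) :
    ∫⁻ z : V, ENNReal.ofReal (|exp (-(‖z - p‖ ^ 2 * t)) - exp (-(‖z - q‖ ^ 2 * t))| *
        |exp (-(‖z - p‖ ^ 2 * τ)) - exp (-(‖z - q‖ ^ 2 * τ))|) =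
      ENNReal.ofReal (2 * (π / (t + τ)) ^ (finrank ℝ V / 2 : ℝ) *
        (1 - exp (-(t * τ / (t + τ) * ‖p - q‖ ^ 2)))) := by
  obtain ⟨hi1, hv1⟩ := integral_exp_mul_exp_neg_norm_sub_sq ht hτ p p
  obtain ⟨hi2, hv2⟩ := integral_exp_mul_exp_neg_norm_sub_sq ht hτ p q
  obtain ⟨hi3, hv3⟩ := integral_exp_mul_exp_neg_norm_sub_sq ht hτ q p
  obtain ⟨hi4, hv4⟩ := integral_exp_mul_exp_neg_norm_sub_sq ht hτ q q
  have key : (fun z : V => |exp (-(‖z - p‖ ^ 2 * t)) - exp (-(‖z - q‖ ^ 2 * t))| *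
        |exp (-(‖z - p‖ ^ 2 * τ)) - exp (-(‖z - q‖ ^ 2 * τ))|) = fun z : V =>
      (exp (-(t * ‖z - p‖ ^ 2)) * exp (-(τ * ‖z - p‖ ^ 2)) -
        exp (-(t * ‖z - p‖ ^ 2)) * exp (-(τ * ‖z - q‖ ^ 2))) -
      (exp (-(t * ‖z - q‖ ^ 2)) * exp (-(τ * ‖z - p‖ ^ 2)) -
        exp (-(t * ‖z - q‖ ^ 2)) * exp (-(τ * ‖z - q‖ ^ 2))) := by
    ext z
    rw [abs_exp_sub_mul_abs_exp_sub ht hτ]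
    simp only [mul_comm _ t, mul_comm _ τ]
    ring
  have hint := (hi1.sub hi2).sub (hi3.sub hi4)
  have hv := integral_sub (hi1.sub hi2) (hi3.sub hi4)
  simp only [Pi.sub_apply] at hv
  rw [← ofReal_integral_eq_lintegral_ofReal (by rw [key]; exact hint)
    (Filter.Eventually.of_forall fun z => by positivity), key, hv,
    integral_sub hi1 hi2, integral_sub hi3 hi4, hv1, hv2, hv3, hv4,
    norm_sub_rev q p]
  simp
  ring_nf

/-- The factor `K` in `∫ (‖z - p‖ ^ (-m) - ‖z - q‖ ^ (-m)) ^ 2 = K * ‖p - q‖ ^ (2 * s)`, where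
`m = (D - 2 * s) / 2` in dimension `D`. -/
def rieszDiffConst (D s : ℝ) : ℝ :=
  2 * π ^ (D / 2) * Gamma (1 - s) * Gamma ((D + 2 * s) / 4) ^ 2 /
    (s * Gamma ((D - 2 * s) / 4) ^ 2 * Gamma ((D + 2 * s) / 2))

theorem lintegral_lintegral_rpow_mul_one_sub_exp {D s c : ℝ} (hs : s ∈ Set.Ioo (0:ℝ) 1)
    (hD : 2 * s < D) (hc : 0 ≤ c) :
    ∫⁻ t in Set.Ioi (0:ℝ), ∫⁻ τ in Set.Ioi (0:ℝ),
      ENNReal.ofReal (t ^ ((D - 2 * s) / 4 - 1) * τ ^ ((D - 2 * s) / 4 - 1) *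
        (2 * (π / (t + τ)) ^ (D / 2) * (1 - exp (-(t * τ / (t + τ) * c))))) =
    ENNReal.ofReal (Gamma ((D - 2 * s) / 4) ^ 2 * (rieszDiffConst D s * c ^ s)) := by
  have hs0 := hs.1
  have hs1 := hs.2
  have h1 : ∀ t ∈ Set.Ioi (0:ℝ), ∫⁻ τ in Set.Ioi (0:ℝ),
      ENNReal.ofReal (t ^ ((D - 2 * s) / 4 - 1) * τ ^ ((D - 2 * s) / 4 - 1) *
        (2 * (π / (t + τ)) ^ (D / 2) * (1 - exp (-(t * τ / (t + τ) * c))))) =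
      ∫⁻ v in Set.Ioi (0:ℝ),
        ENNReal.ofReal (2 * π ^ (D / 2) * v ^ ((D - 2 * s) / 4 - 1) * (1 + v) ^ (-(D / 2))) *
        ENNReal.ofReal (t ^ (-1 - s) * (1 - exp (-(v / (1 + v) * c * t)))) := by
    intro t (ht : 0 < t)
    rw [lintegral_Ioi_comp_mul_left ht]
    refine setLIntegral_congr_fun measurableSet_Ioi fun v (hv : 0 < v) => ?_
    rw [← ENNReal.ofReal_mul ht.le, ← ENNReal.ofReal_mul (by positivity)]
    congr 1
    have e1 : t * (t * v) / (t + t * v) * c = v / (1 + v) * c * t := by field_simp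
    have e2 : t ^ (-1 - s) = t * t ^ ((D - 2 * s) / 4 - 1) * t ^ ((D - 2 * s) / 4 - 1) /
        t ^ (D / 2) := by
      rw [← rpow_one_add' ht.le (by linarith), ← rpow_add ht, ← rpow_sub ht]
      ring_nf
    rw [e1, e2, show t + t * v = t * (1 + v) by ring, div_rpow pi_pos.le (by positivity),
      mul_rpow ht.le (show 0 ≤ 1 + v by positivity), mul_rpow ht.le hv.le, rpow_neg (by positivity)]
    field_simp
  have h2 : ∀ v ∈ Set.Ioi (0:ℝ), ∫⁻ t in Set.Ioi (0:ℝ),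
        ENNReal.ofReal (2 * π ^ (D / 2) * v ^ ((D - 2 * s) / 4 - 1) * (1 + v) ^ (-(D / 2))) *
        ENNReal.ofReal (t ^ (-1 - s) * (1 - exp (-(v / (1 + v) * c * t)))) =
      ENNReal.ofReal (2 * π ^ (D / 2) * (Gamma (1 - s) / s) * c ^ s) *
        ENNReal.ofReal (v ^ ((D + 2 * s) / 4 - 1) *
          (1 + v) ^ (-((D + 2 * s) / 4 + (D + 2 * s) / 4))) := by
    intro v (hv : 0 < v)
    have hG := Gamma_pos_of_pos (sub_pos.2 hs1)
    rw [lintegral_const_mul _ (by fun_prop), lintegral_rpow_mul_one_sub_exp hs (by positivity),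
      ← ENNReal.ofReal_mul (by positivity), ← ENNReal.ofReal_mul (by positivity)]
    congr 1
    rw [mul_rpow (by positivity) hc, div_rpow hv.le (by positivity),
      show (D + 2 * s) / 4 - 1 = (D - 2 * s) / 4 - 1 + s by ring,
      show -((D + 2 * s) / 4 + (D + 2 * s) / 4) = -(D / 2) - s by ring,
      rpow_sub (show 0 < 1 + v by positivity), rpow_add hv]
    ring
  rw [setLIntegral_congr_fun measurableSet_Ioi h1, lintegral_lintegral_swap (by fun_prop),
    setLIntegral_congr_fun measurableSet_Ioi h2, lintegral_const_mul _ (by fun_prop),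
    lintegral_rpow_mul_one_add_rpow (by linarith) (by linarith), ← ENNReal.ofReal_mul]
  · congr 1
    have hG : Gamma ((D - 2 * s) / 4) ≠ 0 := (Gamma_pos_of_pos (by linarith)).ne'
    rw [rieszDiffConst, show (D + 2 * s) / 4 + (D + 2 * s) / 4 = (D + 2 * s) / 2 by ring]
    field_simp
  · have hG := Gamma_pos_of_pos (sub_pos.2 hs1)
    positivity

theorem lintegral_rpow_norm_sub_sq {s : ℝ} (hs : s ∈ Set.Ioo (0:ℝ) 1)
    (hD : 2 * s < finrank ℝ V) (p q : V) :
    ∫⁻ z : V, ENNReal.ofReal ((‖z - p‖ ^ (-((finrank ℝ V - 2 * s) / 2)) -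
        ‖z - q‖ ^ (-((finrank ℝ V - 2 * s) / 2))) ^ 2) =
      ENNReal.ofReal (rieszDiffConst (finrank ℝ V) s * ‖p - q‖ ^ (2 * s)) := by
  set D : ℝ := ((finrank ℝ V : ℕ) : ℝ) with hDdef
  have hs0 := hs.1
  have hV : Nontrivial V := by
    apply Module.nontrivial_of_finrank_pos (R := ℝ)
    have : (0:ℝ) < D := by linarith
    exact Nat.cast_pos.1 this
  have hG : 0 < Gamma ((D - 2 * s) / 4) := Gamma_pos_of_pos (by linarith)
  have hae : ∀ᵐ z : V, z ≠ p ∧ z ≠ q :=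
    (Measure.ae_ne volume p).and (Measure.ae_ne volume q)
  have h1 : ∀ᵐ z : V, ENNReal.ofReal (Gamma ((D - 2 * s) / 4) ^ 2) *
      ENNReal.ofReal ((‖z - p‖ ^ (-((D - 2 * s) / 2)) - ‖z - q‖ ^ (-((D - 2 * s) / 2))) ^ 2) =
      ∫⁻ t in Set.Ioi (0:ℝ), ∫⁻ τ in Set.Ioi (0:ℝ),
        ENNReal.ofReal (t ^ ((D - 2 * s) / 4 - 1) *
          |exp (-(‖z - p‖ ^ 2 * t)) - exp (-(‖z - q‖ ^ 2 * t))|) *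
        ENNReal.ofReal (τ ^ ((D - 2 * s) / 4 - 1) *
          |exp (-(‖z - p‖ ^ 2 * τ)) - exp (-(‖z - q‖ ^ 2 * τ))|) := by
    filter_upwards [hae] with z ⟨hp, hq⟩
    have hp' : 0 < ‖z - p‖ := norm_pos_iff.2 (sub_ne_zero.2 hp)
    have hq' : 0 < ‖z - q‖ := norm_pos_iff.2 (sub_ne_zero.2 hq)
    have hpow : ∀ x : ℝ, 0 < x → (x ^ 2) ^ (-((D - 2 * s) / 4)) = x ^ (-((D - 2 * s) / 2)) := by
      intro x hx
      rw [← rpow_natCast, ← rpow_mul hx.le]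
      congr 1
      push_cast
      ring
    rw [lintegral_lintegral_mul (by fun_prop) (by fun_prop),
      lintegral_rpow_mul_abs_exp_sub (by linarith) (by positivity) (by positivity),
      ← ENNReal.ofReal_mul (by positivity), ← ENNReal.ofReal_mul (by positivity),
      hpow _ hp', hpow _ hq', mul_mul_mul_comm, abs_mul_abs_self]
    ring_nf
  have h2 : ∀ t ∈ Set.Ioi (0:ℝ), ∀ τ ∈ Set.Ioi (0:ℝ),
      ∫⁻ z : V, ENNReal.ofReal (t ^ ((D - 2 * s) / 4 - 1) *
          |exp (-(‖z - p‖ ^ 2 * t)) - exp (-(‖z - q‖ ^ 2 * t))|) *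
        ENNReal.ofReal (τ ^ ((D - 2 * s) / 4 - 1) *
          |exp (-(‖z - p‖ ^ 2 * τ)) - exp (-(‖z - q‖ ^ 2 * τ))|) =
      ENNReal.ofReal (t ^ ((D - 2 * s) / 4 - 1) * τ ^ ((D - 2 * s) / 4 - 1) *
        (2 * (π / (t + τ)) ^ (D / 2) * (1 - exp (-(t * τ / (t + τ) * ‖p - q‖ ^ 2))))) := by
    intro t (ht : 0 < t) τ (hτ : 0 < τ)
    rw [ENNReal.ofReal_mul (p := t ^ ((D - 2 * s) / 4 - 1) * τ ^ ((D - 2 * s) / 4 - 1))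
      (by positivity), ← lintegral_abs_exp_sub_mul_abs_exp_sub ht hτ p q,
      ← lintegral_const_mul _ (by fun_prop)]
    refine lintegral_congr fun z => ?_
    rw [← ENNReal.ofReal_mul (by positivity), ← ENNReal.ofReal_mul (by positivity)]
    congr 1
    ring
  have h3 : ENNReal.ofReal (Gamma ((D - 2 * s) / 4) ^ 2) *
      ∫⁻ z : V, ENNReal.ofReal ((‖z - p‖ ^ (-((D - 2 * s) / 2)) -
        ‖z - q‖ ^ (-((D - 2 * s) / 2))) ^ 2) =
      ENNReal.ofReal (Gamma ((D - 2 * s) / 4) ^ 2) *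
      ENNReal.ofReal (rieszDiffConst D s * ‖p - q‖ ^ (2 * s)) := by
    rw [← lintegral_const_mul _ (by fun_prop), lintegral_congr_ae h1,
      lintegral_lintegral_swap]
    · rw [← ENNReal.ofReal_mul (by positivity), rpow_mul (norm_nonneg _), rpow_two,
        ← lintegral_lintegral_rpow_mul_one_sub_exp hs hD (by positivity)]
      refine setLIntegral_congr_fun measurableSet_Ioi fun t ht => ?_
      rw [lintegral_lintegral_swap (by fun_prop)]
      exact setLIntegral_congr_fun measurableSet_Ioi fun τ hτ => h2 t ht τ hτ
    · refine Measurable.aemeasurable (Measurable.lintegral_prod_right ?_)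
      fun_prop
  exact (ENNReal.mul_right_inj (by simpa using hG.ne') ENNReal.ofReal_ne_top).1 h3

theorem integral_mul_rpow_norm_sub {s m : ℝ} (hs : s ∈ Set.Ioo (0:ℝ) 1)
    (hD : 2 * s < finrank ℝ V) (hm : m = (finrank ℝ V - 2 * s) / 2) (p q r : V) :
    Integrable (fun z : V => (‖z - p‖ ^ (-m) - ‖z - q‖ ^ (-m)) *
      (‖z - p‖ ^ (-m) - ‖z - r‖ ^ (-m))) ∧
    ∫ z : V, (‖z - p‖ ^ (-m) - ‖z - q‖ ^ (-m)) * (‖z - p‖ ^ (-m) - ‖z - r‖ ^ (-m)) =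
      rieszDiffConst (finrank ℝ V) s / 2 *
        (‖p - q‖ ^ (2 * s) + ‖p - r‖ ^ (2 * s) - ‖q - r‖ ^ (2 * s)) := by
  have hs0 := hs.1
  have hK : 0 ≤ rieszDiffConst (finrank ℝ V) s := by
    have := Gamma_pos_of_pos (sub_pos.2 hs.2)
    have : 0 < Gamma ((finrank ℝ V + 2 * s) / 2) := Gamma_pos_of_pos (by linarith)
    unfold rieszDiffConst
    positivity
  have hsq : ∀ x y : V, Integrable (fun z : V => (‖z - x‖ ^ (-m) - ‖z - y‖ ^ (-m)) ^ 2) ∧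
      ∫ z : V, (‖z - x‖ ^ (-m) - ‖z - y‖ ^ (-m)) ^ 2 =
        rieszDiffConst (finrank ℝ V) s * ‖x - y‖ ^ (2 * s) := by
    intro x y
    have h := lintegral_rpow_norm_sub_sq hs hD x y
    rw [← hm] at h
    have hmeas : AEStronglyMeasurable
        (fun z : V => (‖z - x‖ ^ (-m) - ‖z - y‖ ^ (-m)) ^ 2) volume :=
      Measurable.aestronglyMeasurable (by fun_prop)
    have hnn : 0 ≤ᵐ[volume] fun z : V => (‖z - x‖ ^ (-m) - ‖z - y‖ ^ (-m)) ^ 2 :=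
      Filter.Eventually.of_forall fun z => sq_nonneg _
    refine ⟨⟨hmeas, ?_⟩, ?_⟩
    · rw [hasFiniteIntegral_iff_ofReal hnn, h]
      exact ENNReal.ofReal_lt_top
    · rw [integral_eq_lintegral_of_nonneg_ae hnn hmeas, h, ENNReal.toReal_ofReal (by positivity)]
  obtain ⟨i1, v1⟩ := hsq p q
  obtain ⟨i2, v2⟩ := hsq p r
  obtain ⟨i3, v3⟩ := hsq q r
  have key : (fun z : V => (‖z - p‖ ^ (-m) - ‖z - q‖ ^ (-m)) *
      (‖z - p‖ ^ (-m) - ‖z - r‖ ^ (-m))) = fun z : V => 1 / 2 *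
      ((‖z - p‖ ^ (-m) - ‖z - q‖ ^ (-m)) ^ 2 + (‖z - p‖ ^ (-m) - ‖z - r‖ ^ (-m)) ^ 2 -
        (‖z - q‖ ^ (-m) - ‖z - r‖ ^ (-m)) ^ 2) := by
    ext z
    ring
  rw [key]
  refine ⟨((i1.add i2).sub i3).const_mul _, ?_⟩
  have hv := integral_sub (i1.add i2) i3
  simp only [Pi.add_apply] at hv
  rw [integral_const_mul, hv, integral_add i1 i2, v1, v2, v3]
  ring

theorem abs_det_fderiv_inversion {V : Type*} [NormedAddCommGroup V] [InnerProductSpace ℝ V]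
    [FiniteDimensional ℝ V] {x c : V} :
    |((1 / dist x c) ^ 2 • ((ℝ ∙ (x - c))ᗮ.reflection : V →L[ℝ] V)).det| =
      (dist x c ^ (2 * finrank ℝ V))⁻¹ := by
  rw [ContinuousLinearMap.det, ContinuousLinearMap.toLinearMap_smul, LinearMap.det_smul, abs_mul]
  have : |LinearMap.det ((((ℝ ∙ (x - c))ᗮ.reflection : V →L[ℝ] V)) : V →ₗ[ℝ] V)| = 1 := by
    have h := Submodule.det_reflection (ℝ ∙ (x - c))ᗮ
    have h' : |(-1 : ℝ) ^ finrank ℝ ((ℝ ∙ (x - c))ᗮᗮ : Submodule ℝ V)| = 1 := by simp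
    rw [← h']
    exact congrArg _ h
  rw [this, mul_one, abs_of_nonneg (by positivity), ← pow_mul, one_div, inv_pow]

theorem image_inversion_compl_center {V : Type*} [NormedAddCommGroup V]
    [InnerProductSpace ℝ V] (c : V) :
    EuclideanGeometry.inversion c 1 '' {c}ᶜ = {c}ᶜ := by
  rw [Set.image_compl_eq (EuclideanGeometry.inversion_bijective c one_ne_zero)]
  simp

/-- Change of variables under the unit inversion centred at `c`. -/
theorem integral_comp_inversion [Nontrivial V] (c : V) (g : V → ℝ) :
    (Integrable g ↔ Integrable fun z : V => (‖z - c‖ ^ (2 * finrank ℝ V))⁻¹ *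
      g (EuclideanGeometry.inversion c 1 z)) ∧
    ∫ y, g y = ∫ z : V, (‖z - c‖ ^ (2 * finrank ℝ V))⁻¹ *
      g (EuclideanGeometry.inversion c 1 z) := by
  have hs : MeasurableSet ({c}ᶜ : Set V) := (measurableSet_singleton c).compl
  have hd : ∀ x ∈ ({c}ᶜ : Set V), HasFDerivWithinAt (EuclideanGeometry.inversion c 1)
      ((1 / dist x c) ^ 2 • ((ℝ ∙ (x - c))ᗮ.reflection : V →L[ℝ] V)) {c}ᶜ x :=
    fun x hx => (EuclideanGeometry.hasFDerivAt_inversion hx).hasFDerivWithinAt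
  have hinj := (EuclideanGeometry.inversion_injective c one_ne_zero).injOn (s := {c}ᶜ)
  have hr : (volume : Measure V).restrict {c}ᶜ = volume := by simp
  have h1 := integrableOn_image_iff_integrableOn_abs_det_fderiv_smul volume hs hd hinj g
  have h2 := integral_image_eq_integral_abs_det_fderiv_smul volume hs hd hinj g
  simp only [image_inversion_compl_center, IntegrableOn, hr, abs_det_fderiv_inversion,
    smul_eq_mul] at h1 h2
  simp only [dist_eq_norm] at h1 h2
  exact ⟨h1, h2⟩

end

theorem a_sd_mul_rieszDiffConst {d : ℕ} {s : ℝ} (hs : s ∈ Set.Ioo (0:ℝ) 1) (hd : 2 * s < d) :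
    a_sd d s * rieszDiffConst d s = C_fH d s := by
  have hs0 := hs.1
  have h1 := Gamma_pos_of_pos (sub_pos.2 hs.2)
  have h2 : 0 < Gamma (((d:ℝ) + 2 * s) / 2) := Gamma_pos_of_pos (by linarith)
  have h3 : 0 < Gamma (((d:ℝ) - 2 * s) / 4) := Gamma_pos_of_pos (by linarith)
  rw [a_sd, rieszDiffConst, C_fH, neg_div, rpow_neg pi_pos.le, rpow_sub_one two_ne_zero]
  field_simp

/-- The integrand of the interaction term, pulled back by the unit inversion centred at `c`. -/
theorem interaction_integrand_comp_inversion {V : Type*} [NormedAddCommGroup V]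
    [InnerProductSpace ℝ V] {n : ℕ} {s m : ℝ} (hm : m = ((n:ℝ) - 2 * s) / 2) {c p q z : V}
    (hp : c ≠ p) (hq : c ≠ q) (hz : z ≠ c) :
    (‖z - c‖ ^ (2 * n))⁻¹ *
      ((1 - ‖c - p‖ ^ m / ‖EuclideanGeometry.inversion c 1 z - p‖ ^ m) *
        (1 - ‖c - q‖ ^ m / ‖EuclideanGeometry.inversion c 1 z - q‖ ^ m) *
        ‖c - EuclideanGeometry.inversion c 1 z‖ ^ (-((n:ℝ) + 2 * s))) =
      (‖z - c‖ ^ (-m) - ‖z - EuclideanGeometry.inversion c 1 p‖ ^ (-m)) *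
        (‖z - c‖ ^ (-m) - ‖z - EuclideanGeometry.inversion c 1 q‖ ^ (-m)) := by
  have hr : 0 < ‖z - c‖ := norm_pos_iff.2 (sub_ne_zero.2 hz)
  have factor : ∀ a : V, c ≠ a →
      1 - ‖c - a‖ ^ m / ‖EuclideanGeometry.inversion c 1 z - a‖ ^ m =
        ‖z - c‖ ^ m * (‖z - c‖ ^ (-m) - ‖z - EuclideanGeometry.inversion c 1 a‖ ^ (-m)) := by
    intro a ha
    have ha' : 0 < ‖c - a‖ := norm_pos_iff.2 (sub_ne_zero.2 ha)
    have hdist : ‖EuclideanGeometry.inversion c 1 z - a‖ =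
        ‖c - a‖ * ‖z - EuclideanGeometry.inversion c 1 a‖ / ‖z - c‖ := by
      have h := EuclideanGeometry.dist_inversion_inversion hz
        ((EuclideanGeometry.inversion_eq_center one_ne_zero).not.2 ha.symm) 1
      rw [EuclideanGeometry.inversion_inversion c one_ne_zero,
        EuclideanGeometry.dist_inversion_center] at h
      simp only [dist_eq_norm] at h
      rw [h, norm_sub_rev c a]
      field_simp
    rw [hdist, div_rpow (by positivity) hr.le, mul_rpow ha'.le (norm_nonneg _), mul_sub,
      ← rpow_add hr, add_neg_cancel, rpow_zero, rpow_neg (norm_nonneg _)]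
    field_simp
  have hc : ‖c - EuclideanGeometry.inversion c 1 z‖ = ‖z - c‖⁻¹ := by
    rw [← dist_eq_norm, EuclideanGeometry.dist_center_inversion, dist_comm, dist_eq_norm]
    simp
  have hpow : (‖z - c‖ ^ (2 * n))⁻¹ * (‖z - c‖ ^ m * ‖z - c‖ ^ m * ‖z - c‖ ^ ((n:ℝ) + 2 * s)) =
      1 := by
    rw [← rpow_add hr, ← rpow_add hr, ← rpow_natCast, hm]
    push_cast
    rw [show ((n:ℝ) - 2 * s) / 2 + (n - 2 * s) / 2 + (n + 2 * s) = 2 * n by ring]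
    exact inv_mul_cancel₀ (by positivity)
  rw [factor p hp, factor q hq, hc, inv_rpow hr.le, ← rpow_neg hr.le, neg_neg]
  linear_combination ((‖z - c‖ ^ (-m) - ‖z - EuclideanGeometry.inversion c 1 p‖ ^ (-m)) *
        (‖z - c‖ ^ (-m) - ‖z - EuclideanGeometry.inversion c 1 q‖ ^ (-m))) * hpow

/-- **Lemma A.3**: explicit evaluation of the limiting nonlocal interaction term, where
`m = (d−2s)/2`. -/
theorem interaction_term_evaluation
    (d : ℕ) (hd : 0 < d) (s : ℝ) (hs : s ∈ Set.Ioo (0:ℝ) 1)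
    (h4 : (4:ℝ) ≤ (d:ℝ) + 2*s) (m : ℝ) (hm : m = ((d:ℝ) - 2*s)/2)
    (x₁ x₂ x₃ : Euc d) (h12 : x₁ ≠ x₂) (h13 : x₁ ≠ x₃) (h23 : x₂ ≠ x₃) :
    Integrable (fun y : Euc d =>
        (1 - ‖x₁ - x₂‖ ^ m / ‖y - x₂‖ ^ m) * (1 - ‖x₁ - x₃‖ ^ m / ‖y - x₃‖ ^ m) *
          ‖x₁ - y‖ ^ (-((d:ℝ) + 2*s))) ∧
    2 * a_sd d s *
        ∫ y : Euc d,
          (1 - ‖x₁ - x₂‖ ^ m / ‖y - x₂‖ ^ m) * (1 - ‖x₁ - x₃‖ ^ m / ‖y - x₃‖ ^ m) *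
            ‖x₁ - y‖ ^ (-((d:ℝ) + 2*s))
      = C_fH d s *
        (1/‖x₁ - x₂‖^(2*s) + 1/‖x₁ - x₃‖^(2*s)
          + 2 * ⟪x₃ - x₁, x₂ - x₁⟫ /
              (‖x₃ - x₁‖^(2*s) * ‖x₂ - x₁‖^(2*s) * ‖x₂ - x₃‖^(2 - 2*s))
          - ‖x₁ - x₃‖^(2 - 2*s) / (‖x₁ - x₂‖^(2*s) * ‖x₂ - x₃‖^(2 - 2*s))
          - ‖x₁ - x₂‖^(2 - 2*s) / (‖x₁ - x₃‖^(2*s) * ‖x₂ - x₃‖^(2 - 2*s))) := by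
  have hds : 2 * s < d := by linarith [hs.2]
  have hfin : Module.finrank ℝ (Euc d) = d := finrank_euclideanSpace_fin
  have : Nontrivial (Euc d) := ⟨x₁, x₂, h12⟩
  have hA : 0 < ‖x₁ - x₂‖ := norm_pos_iff.2 (sub_ne_zero.2 h12)
  have hB : 0 < ‖x₁ - x₃‖ := norm_pos_iff.2 (sub_ne_zero.2 h13)
  have hC : 0 < ‖x₂ - x₃‖ := norm_pos_iff.2 (sub_ne_zero.2 h23)
  obtain ⟨hiff, hint⟩ := integral_comp_inversion x₁ (fun y : Euc d =>
    (1 - ‖x₁ - x₂‖ ^ m / ‖y - x₂‖ ^ m) * (1 - ‖x₁ - x₃‖ ^ m / ‖y - x₃‖ ^ m) *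
      ‖x₁ - y‖ ^ (-((d:ℝ) + 2*s)))
  obtain ⟨hI, hV⟩ := integral_mul_rpow_norm_sub (V := Euc d) hs (by rwa [hfin]) (by rwa [hfin])
    x₁ (EuclideanGeometry.inversion x₁ 1 x₂) (EuclideanGeometry.inversion x₁ 1 x₃) (m := m)
  rw [hfin] at hiff hint hV
  have hae := (Measure.ae_ne (volume : Measure (Euc d)) x₁).mono fun z hz =>
    interaction_integrand_comp_inversion hm h12 h13 hz
  refine ⟨hiff.2 ((integrable_congr hae).2 hI), ?_⟩
  have hdist : ∀ a : Euc d,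
      ‖x₁ - EuclideanGeometry.inversion x₁ 1 a‖ = ‖x₁ - a‖⁻¹ := fun a => by
    rw [← dist_eq_norm, EuclideanGeometry.dist_center_inversion, dist_eq_norm]
    simp
  have hdist' : ‖EuclideanGeometry.inversion x₁ 1 x₂ - EuclideanGeometry.inversion x₁ 1 x₃‖ =
      ‖x₂ - x₃‖ / (‖x₁ - x₂‖ * ‖x₁ - x₃‖) := by
    rw [← dist_eq_norm, EuclideanGeometry.dist_inversion_inversion h12.symm h13.symm]
    simp only [dist_eq_norm, norm_sub_rev _ x₁]
    ring
  have hinner : 2 * ⟪x₃ - x₁, x₂ - x₁⟫ =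
      ‖x₁ - x₂‖ ^ 2 + ‖x₁ - x₃‖ ^ 2 - ‖x₂ - x₃‖ ^ 2 := by
    have h := norm_sub_sq_real (x₃ - x₁) (x₂ - x₁)
    rw [sub_sub_sub_cancel_right, norm_sub_rev x₃ x₂, norm_sub_rev x₃ x₁, norm_sub_rev x₂ x₁] at h
    linarith
  rw [hint, integral_congr_ae hae, hV, ← a_sd_mul_rieszDiffConst hs hds, hdist, hdist, hdist',
    hinner, norm_sub_rev x₃ x₁, norm_sub_rev x₂ x₁, inv_rpow hA.le, inv_rpow hB.le,
    div_rpow hC.le (by positivity), mul_rpow hA.le hB.le, rpow_sub hA, rpow_sub hB, rpow_sub hC,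
    rpow_two, rpow_two, rpow_two]
  field_simp
  ring
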